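/- Let k ∈ ℤ, A > 0, 0 < s ≤ β < 1, and let D : ℝ^N × ℝ^N → ℝ be measurable with: D(x,y) = 0 whenever d(x,y) ≥ 2^{3-k}; |D(x,y)| ≤ A 2^{kN}; |D(x,z) − D(y,z)| ≤ A 2^{kN} · 2^k d(x,y) for all x, y, z; and ∫_{ℝ^N} D(x,z) dz = 0 for every x. Let f : ℝ^N → ℝ be continuous with |f(x) − f(y)| ≤ F · d(x,y)^s for all x, y, where F ≥ 0. Then for all x, y ∈ ℝ^N, |∫ D(x,z) f(z) dz − ∫ D(y,z) f(z) dz| ≤ C A F 2^{k(β−s)} d(x,y)^β, where C depends only on N, s, β and the cardinality |G| of G. -/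

import Mathlib

open MeasureTheory ENNReal

abbrev Euc (N : ℕ) := EuclideanSpace ℝ (Fin N)

abbrev OrthG (N : ℕ) := Euc N ≃ₗᵢ[ℝ] Euc N

/-- `d(x,y) := min_{σ ∈ G} ‖x - σ(y)‖`. -/
noncomputable def refDist {N : ℕ} (G : Subgroup (OrthG N)) (x y : Euc N) : ℝ :=
  sInf {r : ℝ | ∃ σ ∈ G, r = ‖x - σ y‖}


lemma refDist_nonneg {N : ℕ} (G : Subgroup (OrthG N)) (x y : Euc N) : 0 ≤ refDist G x y := by
  apply Real.sInf_nonneg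
  rintro r ⟨σ, -, rfl⟩
  exact norm_nonneg _

lemma refDist_le {N : ℕ} (G : Subgroup (OrthG N)) (x y : Euc N) {σ : OrthG N} (hσ : σ ∈ G) :
    refDist G x y ≤ ‖x - σ y‖ := by
  refine csInf_le ⟨0, ?_⟩ ⟨σ, hσ, rfl⟩
  rintro r ⟨τ, -, rfl⟩
  exact norm_nonneg _

lemma exists_refDist_eq {N : ℕ} (G : Subgroup (OrthG N)) [Finite G] (x y : Euc N) :
    ∃ σ ∈ G, refDist G x y = ‖x - σ y‖ := by
  have hfin : {r : ℝ | ∃ σ ∈ G, r = ‖x - σ y‖}.Finite := by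
    refine (Set.finite_range fun σ : G => ‖x - (σ : OrthG N) y‖).subset ?_
    rintro r ⟨σ, hσ, rfl⟩
    exact ⟨⟨σ, hσ⟩, rfl⟩
  have hne : {r : ℝ | ∃ σ ∈ G, r = ‖x - σ y‖}.Nonempty := ⟨_, 1, G.one_mem, rfl⟩
  exact hne.csInf_mem hfin

lemma refDist_triangle {N : ℕ} (G : Subgroup (OrthG N)) [Finite G] (x y z : Euc N) :
    refDist G x z ≤ refDist G x y + refDist G y z := by
  obtain ⟨σ, hσ, hxy⟩ := exists_refDist_eq G x y
  obtain ⟨τ, hτ, hyz⟩ := exists_refDist_eq G y z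
  calc refDist G x z ≤ ‖x - (σ * τ) z‖ := refDist_le G x z (G.mul_mem hσ hτ)
    _ = ‖(x - σ y) + σ (y - τ z)‖ := by
        rw [map_sub, sub_add_sub_cancel]; rfl
    _ ≤ ‖x - σ y‖ + ‖σ (y - τ z)‖ := norm_add_le _ _
    _ = refDist G x y + refDist G y z := by rw [σ.norm_map, hxy, hyz]

lemma refDist_ball_subset {N : ℕ} (G : Subgroup (OrthG N)) [Finite G] (x : Euc N) (r : ℝ) :
    {z | refDist G x z < r} ⊆ ⋃ σ : G, Metric.ball ((σ : OrthG N) x) r := by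
  intro z hz
  obtain ⟨σ, hσ, h⟩ := exists_refDist_eq G x z
  refine Set.mem_iUnion.2 ⟨⟨σ⁻¹, G.inv_mem hσ⟩, ?_⟩
  rw [Set.mem_ofPred_eq, h] at hz
  rw [Metric.mem_ball, dist_comm, dist_eq_norm, ← σ.norm_map, map_sub]
  simpa [LinearIsometryEquiv.inv_def] using hz

lemma volume_iUnion_orbit_ball_le {N : ℕ} (G : Subgroup (OrthG N)) [Finite G] (x : Euc N)
    {r : ℝ} (hr : 0 < r) :
    volume.real (⋃ σ : G, Metric.ball ((σ : OrthG N) x) r)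
      ≤ Nat.card G * (r ^ N * volume.real (Metric.ball (0 : Euc N) 1)) := by
  have := Fintype.ofFinite G
  refine (measureReal_iUnion_fintype_le _).trans_eq ?_
  have h (σ : G) : volume.real (Metric.ball ((σ : OrthG N) x) r)
      = r ^ N * volume.real (Metric.ball (0 : Euc N) 1) := by
    rw [measureReal_def, Measure.addHaar_ball_of_pos _ _ hr, finrank_euclideanSpace_fin,
      ENNReal.toReal_mul, ENNReal.toReal_ofReal (by positivity), measureReal_def]
  simp [h, Nat.card_eq_fintype_card]

lemma volume_iUnion_orbit_ball_lt_top {N : ℕ} (G : Subgroup (OrthG N)) [Finite G] (x : Euc N)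
    (r : ℝ) : volume (⋃ σ : G, Metric.ball ((σ : OrthG N) x) r) < ∞ :=
  (Bornology.isBounded_iUnion.2 fun _ => Metric.isBounded_ball).measure_lt_top

lemma integrable_of_bounded_of_refDist {N : ℕ} (G : Subgroup (OrthG N)) [Finite G] {M r : ℝ}
    {h : Euc N → ℝ} {x : Euc N} (hh : Measurable h) (hb : ∀ z, ‖h z‖ ≤ M)
    (hsupp : ∀ z, r ≤ refDist G x z → h z = 0) : Integrable h := by
  have hon : IntegrableOn h (⋃ σ : G, Metric.ball ((σ : OrthG N) x) r) :=
    Measure.integrableOn_of_bounded (volume_iUnion_orbit_ball_lt_top G x r).ne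
      hh.aestronglyMeasurable (M := M) (Filter.Eventually.of_forall hb)
  exact hon.integrable_of_forall_notMem_eq_zero fun z hz =>
    hsupp z (not_lt.1 fun hlt => hz (refDist_ball_subset G x r hlt))

/-- Pairing a bounded kernel of mean zero, supported in an orbit ball, with a Hölder function. -/
lemma integral_mul_holder_le {N : ℕ} (G : Subgroup (OrthG N)) [Finite G] {s F M r : ℝ}
    (hs : 0 < s) (hF : 0 ≤ F) (hM : 0 ≤ M) (hr : 0 < r) {f h : Euc N → ℝ} (hf : Continuous f)
    (x : Euc N) (hfx : ∀ z, |f x - f z| ≤ F * refDist G x z ^ s) (hh : Measurable h)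
    (hb : ∀ z, |h z| ≤ M) (hsupp : ∀ z, r ≤ refDist G x z → h z = 0) (h0 : ∫ z, h z = 0) :
    Integrable (fun z => h z * f z) ∧
      |∫ z, h z * f z| ≤ M * (F * r ^ s) *
        (Nat.card G * (r ^ N * volume.real (Metric.ball (0 : Euc N) 1))) := by
  set S : Set (Euc N) := ⋃ σ : G, Metric.ball ((σ : OrthG N) x) r
  have hSf : volume S < ∞ := volume_iUnion_orbit_ball_lt_top G x r
  have hz : ∀ z ∉ S, h z = 0 := fun z hzS =>
    hsupp z (not_lt.1 fun hlt => hzS (refDist_ball_subset G x r hlt))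
  have hi : Integrable h := integrable_of_bounded_of_refDist G hh hb hsupp
  have hbound (z : Euc N) : ‖h z * (f z - f x)‖ ≤ M * (F * r ^ s) := by
    rw [Real.norm_eq_abs, abs_mul]
    rcases le_or_gt r (refDist G x z) with hle | hlt
    · rw [hsupp z hle, abs_zero, zero_mul]
      positivity
    · refine mul_le_mul (hb z) ?_ (abs_nonneg _) hM
      rw [abs_sub_comm]
      refine (hfx z).trans ?_
      gcongr
      exact refDist_nonneg G x z
  have hi' : Integrable fun z => h z * (f z - f x) :=
    integrable_of_bounded_of_refDist G (hh.mul (hf.measurable.sub_const _)) hbound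
      fun z hz' => by rw [hsupp z hz', zero_mul]
  have heq : (fun z => h z * f z) = fun z => h z * (f z - f x) + h z * f x := by
    funext z; ring
  have hint : ∫ z, h z * f z = ∫ z in S, h z * (f z - f x) := by
    rw [heq, integral_add hi' (hi.mul_const _), integral_mul_const, h0, zero_mul, add_zero,
      setIntegral_eq_integral_of_forall_compl_eq_zero]
    intro z hzS
    rw [hz z hzS, zero_mul]
  refine ⟨heq ▸ hi'.add (hi.mul_const _), ?_⟩
  rw [hint, ← Real.norm_eq_abs]
  refine (norm_setIntegral_le_of_norm_le_const hSf fun z _ => hbound z).trans ?_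
  have := volume_iUnion_orbit_ball_le G x hr
  gcongr

lemma dyadic_scaling (N : ℕ) (k : ℤ) (s β : ℝ) {δ : ℝ} (hδ : 0 ≤ δ) :
    (2 : ℝ) ^ (k * (N : ℤ)) * ((2 : ℝ) ^ k * δ) ^ β * ((2 : ℝ) ^ (4 - k)) ^ s *
      ((2 : ℝ) ^ (4 - k)) ^ N
      = 2 ^ (4 * N) * (2 : ℝ) ^ (4 * s) * (2 : ℝ) ^ ((k : ℝ) * (β - s)) * δ ^ β := by
  rw [Real.mul_rpow (by positivity) hδ]
  have h2 : (0 : ℝ) < 2 := two_pos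
  simp only [← Real.rpow_intCast, ← Real.rpow_natCast, ← Real.rpow_mul h2.le]
  have : ∀ a b c d e : ℝ, (2 : ℝ) ^ a * ((2 : ℝ) ^ b * e) * (2 : ℝ) ^ c * (2 : ℝ) ^ d
      = (2 : ℝ) ^ (a + b + c + d) * e := fun a b c d e => by
    rw [Real.rpow_add h2, Real.rpow_add h2, Real.rpow_add h2]; ring
  rw [this, ← Real.rpow_add h2, ← Real.rpow_add h2]
  push_cast
  ring_nf

/-- improved Hölder estimate `|D_k f(x) - D_k f(y)| ≲ 2^{k(β-s)} d(x,y)^β`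
for Hölder `f`, using the cancellation of `D`. -/
theorem stmt_12 {N : ℕ} (hN : 1 ≤ N) (G : Subgroup (OrthG N)) [Finite G]
    (s β : ℝ) (hs0 : 0 < s) (hsβ : s ≤ β) (hβ1 : β < 1) :
    ∃ C : ℝ, 0 < C ∧
      ∀ (k : ℤ) (A : ℝ), 0 < A →
      ∀ D : Euc N → Euc N → ℝ, Measurable (Function.uncurry D) →
        (∀ x y : Euc N, (2:ℝ) ^ (3 - k) ≤ refDist G x y → D x y = 0) →
        (∀ x y : Euc N, |D x y| ≤ A * (2:ℝ) ^ (k * (N : ℤ))) →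
        (∀ x y z : Euc N, |D x z - D y z| ≤ A * (2:ℝ) ^ (k * (N : ℤ)) * ((2:ℝ) ^ k * refDist G x y)) →
        (∀ x : Euc N, (∫ z : Euc N, D x z) = 0) →
      ∀ F : ℝ, 0 ≤ F →
      ∀ f : Euc N → ℝ, Continuous f →
        (∀ x y : Euc N, |f x - f y| ≤ F * refDist G x y ^ s) →
      ∀ x y : Euc N,
        |(∫ z : Euc N, D x z * f z) - (∫ z : Euc N, D y z * f z)|
          ≤ C * A * F * (2:ℝ) ^ ((k : ℝ) * (β - s)) * refDist G x y ^ β := by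
  set v : ℝ := volume.real (Metric.ball (0 : Euc N) 1)
  have hv0 : 0 < v :=
    ENNReal.toReal_pos (Metric.measure_ball_pos _ _ one_pos).ne' measure_ball_lt_top.ne
  have hG0 : (0 : ℝ) < Nat.card G := Nat.cast_pos.2 Nat.card_pos
  refine ⟨2 * (Nat.card G * v * (2 ^ (4 * N) * (2 : ℝ) ^ (4 * s))), by positivity, ?_⟩
  intro k A hA D hD hsupp hb hlip h0 F hF f hf hfH x y
  set δ := refDist G x y with hδ
  have hδ0 : 0 ≤ δ := refDist_nonneg G x y
  set r : ℝ := (2 : ℝ) ^ (4 - k) with hr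
  have hr0 : 0 < r := by positivity
  have hr2 : r = (2 : ℝ) ^ (3 - k) + (2 : ℝ) ^ (3 - k) := by
    rw [hr, show (4 - k : ℤ) = (3 - k) + 1 by ring, zpow_add_one₀ two_ne_zero]; ring
  have hR0 : (0 : ℝ) < (2 : ℝ) ^ (3 - k) := by positivity
  have hmeas (a : Euc N) : Measurable (D a) := hD.comp measurable_prodMk_left
  have est (a : Euc N) := integral_mul_holder_le G hs0 hF
    (by positivity : 0 ≤ A * (2:ℝ) ^ (k * (N : ℤ))) hr0 hf a (hfH a) (hmeas a) (hb a)
    (fun z hz => hsupp a z (by linarith)) (h0 a)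
  have hDi (a : Euc N) : Integrable (D a) :=
    integrable_of_bounded_of_refDist G (hmeas a) (hb a) (hsupp a)
  have hscale := dyadic_scaling N k s β hδ0
  rw [← hr] at hscale
  set t : ℝ := (2 : ℝ) ^ k * δ with ht
  have ht0 : 0 ≤ t := by positivity
  suffices h : |(∫ z, D x z * f z) - ∫ z, D y z * f z| ≤
      2 * (A * (2:ℝ) ^ (k * (N : ℤ)) * t ^ β * (F * r ^ s) * (Nat.card G * (r ^ N * v))) by
    refine h.trans_eq ?_
    linear_combination 2 * A * F * Nat.card G * v * hscale
  rcases le_or_gt t 1 with ht1 | ht1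
  · have hδR : δ ≤ (2 : ℝ) ^ (3 - k) := by
      rw [zpow_sub₀ two_ne_zero, le_div_iff₀ (by positivity), mul_comm]
      norm_num
      linarith
    have hM0 : 0 ≤ A * (2:ℝ) ^ (k * (N : ℤ)) * t ^ β := by positivity
    have hdiff := (integral_mul_holder_le G hs0 hF hM0 hr0 hf x (hfH x)
      ((hmeas x).sub (hmeas y))
      (fun z => (hlip x y z).trans (by
        gcongr
        exact Real.self_le_rpow_of_le_one ht0 ht1 hβ1.le))
      (fun z hz => by
        have := refDist_triangle G x y z
        simp [hsupp x z (by linarith), hsupp y z (by linarith)])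
      (by simp [integral_sub (hDi x) (hDi y), h0])).2
    simp only [Pi.sub_apply, sub_mul] at hdiff
    rw [integral_sub (est x).1 (est y).1] at hdiff
    refine hdiff.trans (le_mul_of_one_le_left ?_ one_le_two)
    positivity
  · have hone : 1 ≤ t ^ β := Real.one_le_rpow ht1.le (hs0.le.trans hsβ)
    have hle : A * (2:ℝ) ^ (k * (N : ℤ)) * (F * r ^ s) * (Nat.card G * (r ^ N * v))
        ≤ A * (2:ℝ) ^ (k * (N : ℤ)) * t ^ β * (F * r ^ s) * (Nat.card G * (r ^ N * v)) := by
      gcongr ?_ * _ * _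
      exact le_mul_of_one_le_right (by positivity) hone
    rw [two_mul]
    exact (abs_sub _ _).trans (add_le_add ((est x).2.trans hle) ((est y).2.trans hle))
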